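/- Let Â, B̂, F̂ be finite subsets of ℤ × ℤ such that F̂ is nonempty, the x-coordinates of distinct elements of are distinct, B̂_/ ⊆ Â_/, and F̂_/ ∩ Â_/ = ∅. For each positive integer m define C_m = {x + m(y + n) : (x,y) ∈ Â, n ∈ ℕ} ∪ π_m(B̂) ∪ π_m(F̂). Then there exists M such that for all m ≥ M, the set C_m arises as a minimal additive complement in ℤ. ("All eventually periodic sets are eventually MACs.") -/

import Mathlib

open Pointwise

/-- `C` is a minimal additive complement to `W` in `ℤ`. -/
def IsMAC (C W : Set ℤ) : Prop :=
  C + W = Set.univ ∧ ∀ C' : Set ℤ, C' ⊂ C → C' + W ≠ Set.univ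

/-- `C` arises as a minimal additive complement in `ℤ`. -/
def ArisesAsMAC (C : Set ℤ) : Prop :=
  ∃ W : Set ℤ, IsMAC C W

/-- The eventually periodic set of period `m` determined by the patterns
`Ahat` (heads of the arithmetic progressions), `Bhat`, `Fhat`. -/
def patternSet (Ahat Bhat Fhat : Finset (ℤ × ℤ)) (m : ℤ) : Set ℤ :=
  {z : ℤ | ∃ p ∈ Ahat, ∃ n : ℕ, z = p.1 + m * (p.2 + n)} ∪
    ((fun p : ℤ × ℤ => p.1 + m * p.2) '' ↑Bhat) ∪
    ((fun p : ℤ × ℤ => p.1 + m * p.2) '' ↑Fhat)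

/-- A set indexed by `c` is a minimal additive complement as soon as the witnesses `z` are
compatible and every integer that is not a witness can be reached without touching witnesses. -/
lemma arisesAsMAC_range_of_witnesses {ι : Type*} (c z : ι → ℤ)
    (hcompat : ∀ i j k, c k + (z i - c i) = z j → c k = c j)
    (hcover : ∀ y, (∃ i, y = z i) ∨ ∃ i, ∀ j k, c k + (y - c i) ≠ z j) :
    ArisesAsMAC (Set.range c) := by
  refine ⟨{w | ∀ j k, c k + w = z j → c k = c j}, ?_, ?_⟩
  · refine Set.eq_univ_of_forall fun y => ?_
    rcases hcover y with ⟨i, rfl⟩ | ⟨i, hi⟩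
    · exact Set.mem_add.2 ⟨c i, ⟨i, rfl⟩, z i - c i, hcompat i, by ring⟩
    · exact Set.mem_add.2 ⟨c i, ⟨i, rfl⟩, y - c i, fun j k h => absurd h (hi j k), by ring⟩
  · intro C' hC' huniv
    obtain ⟨hsub, hne⟩ := Set.ssubset_iff_subset_ne.1 hC'
    obtain ⟨_, ⟨i, rfl⟩, hi⟩ := Set.exists_of_ssubset hC'
    obtain ⟨x, hx, w, hw, hxw⟩ := Set.mem_add.1 (huniv ▸ Set.mem_univ (z i) : z i ∈ C' + _)
    obtain ⟨k, rfl⟩ := hsub hx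
    exact hi (hw i k hxw ▸ hx)

lemma eq_zero_of_mul_eq_mul_add {K N m Δ d k : ℤ} (hd : |d| < K) (hΔ : |Δ| ≤ N)
    (hm : K * (N + 1) ≤ m) (h : m * k = K * Δ + d) : k = 0 ∧ Δ = 0 ∧ d = 0 := by
  have hK : 0 < K := (abs_nonneg d).trans_lt hd
  have hlt : |m * k| < m := by
    rw [h]
    calc |K * Δ + d| ≤ |K * Δ| + |d| := abs_add_le _ _
      _ = K * |Δ| + |d| := by rw [abs_mul, abs_of_pos hK]
      _ < K * N + K := by nlinarith
      _ ≤ m := by linarith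
  have hmpos : 0 < m := (abs_nonneg _).trans_lt hlt
  have hk : k = 0 := Int.abs_lt_one_iff.1 (by
    rw [abs_mul, abs_of_pos hmpos] at hlt
    nlinarith)
  subst hk
  have hd' : d = K * -Δ := by linarith
  have hΔ0 : -Δ = 0 := Int.abs_lt_one_iff.1 (by
    rw [hd', abs_mul, abs_of_pos hK] at hd
    nlinarith)
  exact ⟨rfl, by linarith, by rw [hd', hΔ0, mul_zero]⟩

/-- Indices `((x, y), b), n` of the elements `x + m * (y + n)`: a progression is marked by
`b = true`, a single point by `b = false`, in which case only `n = 0` is allowed. -/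
abbrev ElementIndex (S : Finset ((ℤ × ℤ) × Bool)) : Type :=
  {q : ((ℤ × ℤ) × Bool) × ℕ // q.1 ∈ S ∧ (q.1.2 = false → q.2 = 0)}

lemma arisesAsMAC_of_index (S : Finset ((ℤ × ℤ) × Bool)) (u v : (ℤ × ℤ) × Bool)
    (hu : u ∈ S) (hv : v ∈ S)
    (hmax : ∀ s ∈ S, s.1.1 = u.1.1 → s.2 = false ∧ s.1.2 ≤ u.1.2)
    (hmin : ∀ s ∈ S, s.1.1 = v.1.1 → s.2 = false ∧ v.1.2 ≤ s.1.2)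
    (e : (ℤ × ℤ) × Bool → ℤ) (he : Function.Injective e) {D N K m : ℤ}
    (hD : ∀ s ∈ S, |s.1.1| ≤ D) (hN : ∀ s ∈ S, ∀ t ∈ S, |e s - e t| ≤ N)
    (hK : 4 * D < K) (hm : K * (N + 1) ≤ m) :
    ArisesAsMAC (Set.range fun q : ElementIndex S => q.1.1.1.1 + m * (q.1.1.1.2 + q.1.2)) := by
  have key : ∀ s ∈ S, ∀ t ∈ S, ∀ d k : ℤ, |d| ≤ 4 * D → m * k = K * (e s - e t) + d →
      k = 0 ∧ s = t ∧ d = 0 := by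
    intro s hs t ht d k hd h
    obtain ⟨h1, h2, h3⟩ :=
      eq_zero_of_mul_eq_mul_add (hd.trans_lt hK) (hN s hs t ht) hm h
    exact ⟨h1, he (sub_eq_zero.1 h2), h3⟩
  have hdiff : ∀ s ∈ S, ∀ t ∈ S, |s.1.1 - t.1.1| ≤ 2 * D := by
    intro s hs t ht
    have := abs_le.1 (hD s hs)
    have := abs_le.1 (hD t ht)
    exact abs_le.2 ⟨by linarith, by linarith⟩
  have hDnonneg : 0 ≤ D := (abs_nonneg _).trans (hD u hu)
  refine arisesAsMAC_range_of_witnesses _ (fun q => K * e q.1.1 + m * q.1.2) ?_ ?_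
  · rintro ⟨⟨s, n⟩, hs, hn⟩ ⟨⟨s', n'⟩, hs', hn'⟩ ⟨⟨s₁, n₁⟩, hs₁, hn₁⟩ h
    dsimp only at h hs hn hs' hn' hs₁ hn₁ ⊢
    have hx := hdiff s hs s₁ hs₁
    obtain ⟨h1, rfl, h3⟩ := key s' hs' s hs (s.1.1 - s₁.1.1)
      (s₁.1.2 + n₁ - s.1.2 - n + n - n') (by linarith) (by linear_combination h)
    linear_combination m * h1 - h3
  · intro y
    by_cases hy : ∃ s ∈ S, ∃ k : ℤ, y = K * e s + m * k
    · obtain ⟨s, hs, k, rfl⟩ := hy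
      rcases lt_trichotomy k 0 with hk | rfl | hk
      · refine Or.inr ⟨⟨(u, 0), hu, fun _ => rfl⟩, ?_⟩
        rintro ⟨⟨s', n'⟩, hs', hn'⟩ ⟨⟨s₁, n₁⟩, hs₁, hn₁⟩ h
        dsimp only at h hs' hn' hs₁ hn₁
        have hx := hdiff u hu s₁ hs₁
        obtain ⟨h1, rfl, h3⟩ := key s' hs' s hs (u.1.1 - s₁.1.1)
          (s₁.1.2 + n₁ - u.1.2 + k - n') (by linarith) (by
            push_cast at h
            linear_combination h)
        obtain ⟨hf, hle⟩ := hmax s₁ hs₁ (by linarith)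
        have := hn₁ hf
        omega
      · exact Or.inl ⟨⟨(s, 0), hs, fun _ => rfl⟩, by simp⟩
      · by_cases hb : s.2 = false
        · refine Or.inr ⟨⟨(v, 0), hv, fun _ => rfl⟩, ?_⟩
          rintro ⟨⟨s', n'⟩, hs', hn'⟩ ⟨⟨s₁, n₁⟩, hs₁, hn₁⟩ h
          dsimp only at h hs' hn' hs₁ hn₁
          have hx := hdiff v hv s₁ hs₁
          obtain ⟨h1, rfl, h3⟩ := key s' hs' s hs (v.1.1 - s₁.1.1)
            (s₁.1.2 + n₁ - v.1.2 + k - n') (by linarith) (by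
              push_cast at h
              linear_combination h)
          obtain ⟨hf, hle⟩ := hmin s₁ hs₁ (by linarith)
          have := hn' hb
          omega
        · refine Or.inl ⟨⟨(s, k.toNat), hs, fun h => absurd h hb⟩, ?_⟩
          simp [hk.le]
    · right
      by_cases hd : ∃ s ∈ S, ∃ d k : ℤ, |d| ≤ 2 * D ∧ y = K * e s + d + m * k
      · obtain ⟨s, hs, d, k, hdD, rfl⟩ := hd
        have hd0 : d ≠ 0 := by
          rintro rfl
          exact hy ⟨s, hs, k, by ring⟩
        have hside : ∃ t ∈ S, ∀ s₁ ∈ S, s₁.1.1 - t.1.1 + d ≠ 0 := by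
          rcases lt_or_gt_of_ne hd0 with hneg | hpos
          · obtain ⟨t, ht, hle⟩ := S.exists_max_image (fun s => s.1.1) ⟨u, hu⟩
            refine ⟨t, ht, fun s₁ hs₁ => ?_⟩
            have := hle s₁ hs₁
            omega
          · obtain ⟨t, ht, hle⟩ := S.exists_min_image (fun s => s.1.1) ⟨u, hu⟩
            refine ⟨t, ht, fun s₁ hs₁ => ?_⟩
            have := hle s₁ hs₁
            omega
        obtain ⟨t, ht, hne⟩ := hside
        refine ⟨⟨(t, 0), ht, fun _ => rfl⟩, ?_⟩
        rintro ⟨⟨s', n'⟩, hs', hn'⟩ ⟨⟨s₁, n₁⟩, hs₁, hn₁⟩ h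
        dsimp only at h hs' hn' hs₁ hn₁
        have hx := abs_le.1 (hdiff t ht s₁ hs₁)
        have hdD' := abs_le.1 hdD
        obtain ⟨-, -, h3⟩ := key s' hs' s hs (t.1.1 - s₁.1.1 - d)
          (s₁.1.2 + n₁ - t.1.2 + k - n') (abs_le.2 ⟨by linarith, by linarith⟩) (by
            push_cast at h
            linear_combination h)
        exact hne s₁ hs₁ (by linarith)
      · refine ⟨⟨(u, 0), hu, fun _ => rfl⟩, ?_⟩
        rintro ⟨⟨s', n'⟩, hs', hn'⟩ ⟨⟨s₁, n₁⟩, hs₁, hn₁⟩ h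
        dsimp only at h hs' hn' hs₁ hn₁
        refine hd ⟨s', hs', u.1.1 - s₁.1.1, n' - (s₁.1.2 + n₁ - u.1.2),
          hdiff u hu s₁ hs₁, ?_⟩
        push_cast at h
        linear_combination h

lemma patternSet_eq_range (Ahat Bhat Fhat : Finset (ℤ × ℤ)) (m : ℤ)
    (S : Finset ((ℤ × ℤ) × Bool))
    (hS : ∀ p, ((p, true) ∈ S ↔ p ∈ Ahat) ∧ ((p, false) ∈ S ↔ p ∈ Bhat ∨ p ∈ Fhat)) :
    patternSet Ahat Bhat Fhat m =
      Set.range fun q : ElementIndex S => q.1.1.1.1 + m * (q.1.1.1.2 + q.1.2) := by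
  ext c
  constructor
  · rintro ((⟨p, hp, n, rfl⟩ | ⟨p, hp, rfl⟩) | ⟨p, hp, rfl⟩)
    · exact ⟨⟨((p, true), n), (hS p).1.2 hp, by simp⟩, rfl⟩
    · exact ⟨⟨((p, false), 0), (hS p).2.2 (Or.inl hp), by simp⟩, by simp⟩
    · exact ⟨⟨((p, false), 0), (hS p).2.2 (Or.inr hp), by simp⟩, by simp⟩
  · rintro ⟨⟨⟨⟨p, b⟩, n⟩, hp, hn⟩, rfl⟩
    cases b
    · obtain rfl : n = 0 := hn rfl
      rcases (hS p).2.1 hp with h | h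
      · exact Or.inl (Or.inr ⟨p, h, by simp⟩)
      · exact Or.inr ⟨p, h, by simp⟩
    · exact Or.inl (Or.inl ⟨p, (hS p).1.1 hp, n, rfl⟩)

theorem all_eventually_periodic_sets_eventually_MACs
    (Ahat Bhat Fhat : Finset (ℤ × ℤ))
    (hFne : Fhat.Nonempty)
    (hAinj : ∀ p ∈ Ahat, ∀ q ∈ Ahat, p.1 = q.1 → p = q)
    (hBA : Bhat.image Prod.fst ⊆ Ahat.image Prod.fst)
    (hFA : Fhat.image Prod.fst ∩ Ahat.image Prod.fst = ∅) :
    ∃ M : ℤ, ∀ m : ℤ, M ≤ m → ArisesAsMAC (patternSet Ahat Bhat Fhat m) := by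
  classical
  set S : Finset ((ℤ × ℤ) × Bool) :=
    Ahat.image (fun p => (p, true)) ∪ (Bhat ∪ Fhat).image (fun p => (p, false)) with hSdef
  have hS : ∀ p, ((p, true) ∈ S ↔ p ∈ Ahat) ∧ ((p, false) ∈ S ↔ p ∈ Bhat ∨ p ∈ Fhat) := by
    intro p
    simp [hSdef]
  have hFA' : ∀ f ∈ Fhat, ∀ p ∈ Ahat, p.1 ≠ f.1 := by
    intro f hf p hp h
    have : f.1 ∈ Fhat.image Prod.fst ∩ Ahat.image Prod.fst :=
      Finset.mem_inter.2 ⟨Finset.mem_image_of_mem _ hf, h ▸ Finset.mem_image_of_mem _ hp⟩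
    simp [hFA] at this
  have hcol : ∀ f ∈ Fhat, ∀ s ∈ S, s.1.1 = f.1 → s.2 = false ∧ s.1 ∈ Fhat := by
    rintro f hf ⟨p, b⟩ hs h
    cases b
    · refine ⟨rfl, ((hS p).2.1 hs).resolve_left fun hB => ?_⟩
      obtain ⟨q, hq, hqp⟩ := Finset.mem_image.1 (hBA (Finset.mem_image_of_mem _ hB))
      exact hFA' f hf q hq (hqp.trans h)
    · exact absurd h (hFA' f hf p ((hS p).1.1 hs))
  obtain ⟨u, hu, hmax⟩ := Fhat.exists_max_image Prod.snd hFne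
  obtain ⟨v, hv, hmin⟩ := Fhat.exists_min_image Prod.snd hFne
  obtain ⟨D, hD⟩ := (S.image fun s => |s.1.1|).bddAbove
  obtain ⟨N, hN⟩ := ((S ×ˢ S).image fun p =>
    |(Encodable.encode p.1 : ℤ) - Encodable.encode p.2|).bddAbove
  refine ⟨(4 * D + 1) * (N + 1), fun m hm => ?_⟩
  rw [patternSet_eq_range Ahat Bhat Fhat m S hS]
  refine arisesAsMAC_of_index S (u, false) (v, false) ((hS u).2.2 (Or.inr hu))
    ((hS v).2.2 (Or.inr hv)) ?_ ?_ (fun s => (Encodable.encode s : ℤ))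
    (fun s t h => Encodable.encode_injective (Int.ofNat.inj h))
    (fun s hs => hD (Finset.mem_coe.2 (Finset.mem_image.2 ⟨s, hs, rfl⟩)))
    (fun s hs t ht => hN (Finset.mem_coe.2 (Finset.mem_image.2
      ⟨(s, t), Finset.mem_product.2 ⟨hs, ht⟩, rfl⟩))) (lt_add_one _) hm
  · intro s hs h
    obtain ⟨hf, hF⟩ := hcol u hu s hs h
    exact ⟨hf, hmax _ hF⟩
  · intro s hs h
    obtain ⟨hf, hF⟩ := hcol v hv s hs h
    exact ⟨hf, hmin _ hF⟩
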